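/- Let k_x, k_1, …, k_n be elements of a real inner product space H with ‖k_x‖ = 1. Let G ∈ ℝ^{n×n} be the Gram matrix G_{ij} = ⟨k_i, k_j⟩ and R ∈ ℝⁿ the vector R_i = ⟨k_x, k_i⟩. If M ∈ ℝⁿ satisfies G M = R, then ⟨M, R⟩ ≤ 1 and for every f ∈ H the pointwise error is bounded by |⟨f, k_x − Σ_{j=1}^n M_j k_j⟩| ≤ √(1 − ⟨M, R⟩) · ‖f‖. -/

import Mathlib

open Matrix
open scoped RealInnerProductSpace

/-- If `‖k_x‖ = 1` and `M` solves the normal equations `G M = R` for the Gram matrix `G` of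
the `k j` and `R i = ⟨k_x, k i⟩`, then `⟨M, R⟩ ≤ 1` and the pointwise error functional is
bounded by `|⟨f, k_x − Σⱼ M j • k j⟩| ≤ √(1 − ⟨M, R⟩) ‖f‖` for every `f`. -/
theorem stmt_9 {H : Type*} [NormedAddCommGroup H] [InnerProductSpace ℝ H]
    {n : ℕ} (kx : H) (k : Fin n → H) (hkx : ‖kx‖ = 1) (M : Fin n → ℝ)
    (hM : (Matrix.of fun i j => ⟪k i, k j⟫).mulVec M = fun i => ⟪kx, k i⟫) :
    M ⬝ᵥ (fun i => ⟪kx, k i⟫) ≤ 1 ∧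
      ∀ f : H, |⟪f, kx - ∑ j, M j • k j⟫| ≤
        Real.sqrt (1 - M ⬝ᵥ (fun i => ⟪kx, k i⟫)) * ‖f‖ := by
  set s := ∑ j, M j • k j with hs
  have h_kx : M ⬝ᵥ (fun i => ⟪kx, k i⟫) = ⟪kx, s⟫ := by
    simp [hs, dotProduct, inner_sum, real_inner_smul_right]
  have h_normal (i : Fin n) : ⟪k i, s⟫ = ⟪kx, k i⟫ := by
    rw [← congrFun hM i]
    simp [hs, mulVec, dotProduct, inner_sum, real_inner_smul_right, mul_comm]
  have h_self : ⟪s, s⟫ = ⟪kx, s⟫ := by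
    rw [← h_kx]
    conv_lhs => enter [2]; rw [hs]
    simp [sum_inner, real_inner_smul_left, h_normal, dotProduct]
  have h_norm : ‖kx - s‖ ^ 2 = 1 - ⟪kx, s⟫ := by
    rw [norm_sub_sq_real, hkx, ← real_inner_self_eq_norm_sq s, h_self]
    ring
  rw [h_kx]
  refine ⟨by linarith [sq_nonneg ‖kx - s‖], fun f => ?_⟩
  rw [← h_norm, Real.sqrt_sq (norm_nonneg _), mul_comm]
  exact abs_real_inner_le_norm f (kx - s)
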